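/- arXiv:1601.06218 — 2 statements merged into one kernel-verified Lean document; each statement's English description precedes it below -/
import Mathlib

section
/- Let A be a C*-algebra, (e_j)_{j≥1} a sequence of nonzero elements of A, and K ≥ 1 a constant such that for all integers n ≥ 1, all l ≥ m ≥ 1, and all matrices u_1, …, u_l ∈ M_n(ℂ): ‖∑_{j=1}^m u_j ⊗ e_j‖_{M_n(A)} ≤ K·‖∑_{j=1}^l u_j ⊗ e_j‖_{M_n(A)}. Then (e_j) is a Schauder basis of the closed linear span E of {e_j : j ≥ 1} in A, and for every m the basis projection P_m: E → E, P_m(∑_j α_j e_j) = ∑_{j=1}^m α_j e_j, satisfies: for every n, the entrywise amplification of P_m, acting on the matrices in M_n(A) all of whose entries lie in E (with the norm of M_n(A)), has norm at most K. That is, (e_j) is a cb-basic sequence with cb-basis constant at most K. -/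
open Filter

section Seminorm

variable {A : Type*} [NonUnitalCStarAlgebra A]

lemma IsSelfAdjoint.exists_mul_self_add_mul_self_eq {h : A} (hh : IsSelfAdjoint h)
    (h1 : ‖h‖ ≤ 1) :
    ∃ w : A, IsSelfAdjoint w ∧ Commute h w ∧ h * h * (h * h) + w * w = h * h := by
  have hid : cfcₙ (fun x : ℝ => x) h = h := cfcₙ_id' ℝ h
  have hsq : cfcₙ (fun x : ℝ => x * x) h = h * h := by
    rw [cfcₙ_mul (fun x : ℝ => x) (fun x => x) h, hid]
  refine ⟨cfcₙ (fun x : ℝ => x * √(1 - x * x)) h, cfcₙ_predicate _ h, ?_, ?_⟩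
  · simpa only [hid] using
      cfcₙ_commute_cfcₙ (fun x : ℝ => x) (fun x : ℝ => x * √(1 - x * x)) h
  · rw [← hsq, ← cfcₙ_mul (fun x : ℝ => x * x) (fun x => x * x) h,
      ← cfcₙ_mul (fun x : ℝ => x * √(1 - x * x)) (fun x : ℝ => x * √(1 - x * x)) h,
      ← cfcₙ_add (fun x : ℝ => x * x * (x * x))
        (fun x : ℝ => x * √(1 - x * x) * (x * √(1 - x * x))) h]
    refine cfcₙ_congr fun x hx => ?_
    have hx1 : |x| ≤ 1 :=
      (NonUnitalIsometricContinuousFunctionalCalculus.norm_quasispectrum_le h hx).trans h1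
    have hx2 : 0 ≤ 1 - x * x := by nlinarith [abs_mul_abs_self x, abs_nonneg x]
    have := Real.mul_self_sqrt hx2
    linear_combination x * x * this

/-- A seminorm on a C⋆-algebra satisfying the C⋆-identity is dominated by the norm. -/
theorem Seminorm.le_norm_of_star_mul_self (p : Seminorm ℂ A)
    (hp : ∀ a, p (star a * a) = p a ^ 2) (a : A) : p a ≤ ‖a‖ := by
  have unit_ball : ∀ h : A, IsSelfAdjoint h → ‖h‖ ≤ 1 → p h ≤ 1 := by
    intro h hh h1
    obtain ⟨w, hw, hc, hsum⟩ := hh.exists_mul_self_add_mul_self_eq h1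
    have hc2 : h * h * w = w * (h * h) := (hc.mul_left hc).eq
    have key : ∀ ε : ℂ, star ε = -ε → ε * ε = -1 → p (h * h + ε • w) = p h := by
      intro ε hε hε2
      have h2 : star (h * h + ε • w) * (h * h + ε • w) = star h * h := by
        have hww : ε • ε • (w * w) = -(w * w) := by rw [smul_smul, hε2, neg_one_smul]
        simp only [star_add, star_mul, star_smul, hh.star_eq, hw.star_eq, hε, add_mul, mul_add,
          smul_mul_assoc, mul_smul_comm, neg_smul, neg_mul, smul_add, smul_neg, hc2, hww]
        conv_rhs => rw [← hsum]
        abel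
      have := hp (h * h + ε • w)
      rw [h2, hp] at this
      exact ((sq_eq_sq₀ (apply_nonneg p _) (apply_nonneg p _)).mp this).symm
    have hI := key Complex.I (by simp) (by simp)
    have hI' := key (-Complex.I) (by simp) (by simp)
    have hadd : (2 : ℂ) • (h * h) = (h * h + Complex.I • w) + (h * h + (-Complex.I) • w) := by
      rw [two_smul, neg_smul]; abel
    have hle : p ((2 : ℂ) • (h * h)) ≤ p h + p h := by
      rw [hadd, ← hI]
      refine (map_add_le_add p _ _).trans ?_
      rw [hI', hI]
    have h2 : p (h * h) = p h ^ 2 := by simpa [hh.star_eq] using hp h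
    rw [map_smul_eq_mul, h2, Complex.norm_ofNat] at hle
    nlinarith [apply_nonneg p h]
  have self_adjoint : ∀ h : A, IsSelfAdjoint h → p h ≤ ‖h‖ := by
    intro h hh
    rcases eq_or_ne h 0 with rfl | h0
    · simp
    have hpos : 0 < ‖h‖ := norm_pos_iff.mpr h0
    have := unit_ball (((‖h‖⁻¹ : ℝ) : ℂ) • h)
      (by rw [IsSelfAdjoint, star_smul, hh.star_eq]; simp)
      (by rw [norm_smul]; simp [hpos.ne'])
    rw [map_smul_eq_mul, Complex.norm_real, norm_inv, norm_norm, inv_mul_le_iff₀ hpos,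
      mul_one] at this
    exact this
  have := self_adjoint (star a * a) (IsSelfAdjoint.star_mul_self a)
  rw [hp, CStarRing.norm_star_mul_self, ← sq] at this
  exact le_of_sq_le_sq this (norm_nonneg a)

variable {n : Type*} [Fintype n] [DecidableEq n]

/-- A seminorm on matrices over a C⋆-algebra which satisfies the C⋆-identity is dominated by the
sum of the norms of the entries. -/
theorem Seminorm.le_sum_norm_of_star_mul_self (p : Seminorm ℂ (Matrix n n A))
    (hp : ∀ x, p (star x * x) = p x ^ 2) (x : Matrix n n A) :
    p x ≤ ∑ i, ∑ j, ‖x i j‖ := by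
  have hmul : ∀ (i j : n) (a : A), star (Matrix.single i j a) * Matrix.single i j a =
      Matrix.single j j (star a * a) := by
    intro i j a
    rw [Matrix.star_eq_conjTranspose, Matrix.conjTranspose_single, Matrix.single_mul_single_same]
  have hdiag : ∀ (i : n) (a : A), p (Matrix.single i i a) ≤ ‖a‖ := fun i a =>
    (p.comp (Matrix.singleLinearMap ℂ i i)).le_norm_of_star_mul_self
      (fun b => by
        simp only [Seminorm.comp_apply, Matrix.singleLinearMap_apply]
        rw [← hmul, hp]) a
  have hsingle : ∀ (i j : n) (a : A), p (Matrix.single i j a) ≤ ‖a‖ := by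
    intro i j a
    have := hdiag j (star a * a)
    rw [← hmul i j, hp, CStarRing.norm_star_mul_self, ← sq] at this
    exact le_of_sq_le_sq this (norm_nonneg a)
  conv_lhs => rw [Matrix.matrix_eq_sum_single x]
  refine (Finset.le_sum_of_subadditive p (map_zero p).le (map_add_le_add p) _ _).trans ?_
  gcongr with i
  refine (Finset.le_sum_of_subadditive p (map_zero p).le (map_add_le_add p) _ _).trans ?_
  gcongr with j
  exact hsingle i j _

/-- A seminorm on matrices over a C⋆-algebra which satisfies the C⋆-identity is continuous with
respect to entrywise convergence. -/
theorem Seminorm.tendsto_of_star_mul_self (p : Seminorm ℂ (Matrix n n A))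
    (hp : ∀ x, p (star x * x) = p x ^ 2) {ι : Type*} {l : Filter ι} {x : ι → Matrix n n A}
    {y : Matrix n n A} (hx : ∀ i j, Tendsto (fun k => x k i j) l (nhds (y i j))) :
    Tendsto (fun k => p (x k)) l (nhds (p y)) := by
  have hlim : Tendsto (fun k => ∑ i, ∑ j, ‖(x k - y) i j‖) l (nhds 0) := by
    rw [show (0 : ℝ) = ∑ i : n, ∑ j : n, 0 by simp]
    refine tendsto_finsetSum _ fun i _ => tendsto_finsetSum _ fun j _ => ?_
    simpa using tendsto_iff_norm_sub_tendsto_zero.mp (hx i j)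
  rw [tendsto_iff_norm_sub_tendsto_zero]
  exact squeeze_zero (fun _ => norm_nonneg _)
    (fun k => (p.norm_sub_map_le_sub (x k) y).trans (p.le_sum_norm_of_star_mul_self hp _)) hlim

end Seminorm

section Basis

variable {𝕜 E : Type*} [RCLike 𝕜] [NormedAddCommGroup E] [NormedSpace 𝕜 E] {e : ℕ → E} {K : ℝ}

lemma exists_eventually_eq_sum_range_of_mem_span {x : E}
    (hx : x ∈ Submodule.span 𝕜 (Set.range e)) :
    ∃ α : ℕ → 𝕜, ∀ᶠ N in atTop, ∑ j ∈ Finset.range N, α j • e j = x := by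
  obtain ⟨c, rfl⟩ := (Finsupp.mem_span_range_iff_exists_finsupp).mp hx
  refine ⟨c, ?_⟩
  filter_upwards [eventually_ge_atTop (c.support.sup id + 1)] with N hN
  refine (Finset.sum_subset (fun j hj => ?_) fun j _ hj => ?_).symm
  · have : j ≤ c.support.sup id := Finset.le_sup (f := id) hj
    exact Finset.mem_range.mpr (by omega)
  · simp [Finsupp.notMem_support_iff.mp hj]

lemma norm_sum_range_le_of_tendsto
    (hK : ∀ (α : ℕ → 𝕜) (m l : ℕ), m ≤ l →
      ‖∑ j ∈ Finset.range m, α j • e j‖ ≤ K * ‖∑ j ∈ Finset.range l, α j • e j‖)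
    {α : ℕ → 𝕜} {v : E}
    (hα : Tendsto (fun N => ∑ j ∈ Finset.range N, α j • e j) atTop (nhds v)) (m : ℕ) :
    ‖∑ j ∈ Finset.range m, α j • e j‖ ≤ K * ‖v‖ :=
  ge_of_tendsto (hα.norm.const_mul K) ((eventually_ge_atTop m).mono fun l hl => hK α m l hl)

lemma norm_coeff_mul_norm_le_of_tendsto
    (hK : ∀ (α : ℕ → 𝕜) (m l : ℕ), m ≤ l →
      ‖∑ j ∈ Finset.range m, α j • e j‖ ≤ K * ‖∑ j ∈ Finset.range l, α j • e j‖)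
    {α : ℕ → 𝕜} {v : E}
    (hα : Tendsto (fun N => ∑ j ∈ Finset.range N, α j • e j) atTop (nhds v)) (j : ℕ) :
    ‖α j‖ * ‖e j‖ ≤ 2 * K * ‖v‖ := by
  have h1 := norm_sum_range_le_of_tendsto hK hα j
  have h2 := norm_sum_range_le_of_tendsto hK hα (j + 1)
  have h3 : α j • e j = ∑ i ∈ Finset.range (j + 1), α i • e i - ∑ i ∈ Finset.range j, α i • e i := by
    rw [Finset.sum_range_succ]; abel
  rw [← norm_smul, h3]
  linarith [norm_sub_le (∑ i ∈ Finset.range (j + 1), α i • e i) (∑ i ∈ Finset.range j, α i • e i)]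

/-- Grünblum's criterion: a sequence of nonzero vectors whose partial sums are dominated by later
ones is a Schauder basis of its closed linear span. -/
theorem existsUnique_tendsto_sum_range_of_norm_le (he : ∀ j, e j ≠ 0)
    (hK : ∀ (α : ℕ → 𝕜) (m l : ℕ), m ≤ l →
      ‖∑ j ∈ Finset.range m, α j • e j‖ ≤ K * ‖∑ j ∈ Finset.range l, α j • e j‖)
    {v : E} (hv : v ∈ (Submodule.span 𝕜 (Set.range e)).topologicalClosure) :
    ∃! α : ℕ → 𝕜, Tendsto (fun N => ∑ j ∈ Finset.range N, α j • e j) atTop (nhds v) := by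
  have sub_tendsto : ∀ {α β : ℕ → 𝕜} {x y : E},
      Tendsto (fun N => ∑ j ∈ Finset.range N, α j • e j) atTop (nhds x) →
      Tendsto (fun N => ∑ j ∈ Finset.range N, β j • e j) atTop (nhds y) →
      Tendsto (fun N => ∑ j ∈ Finset.range N, (α - β) j • e j) atTop (nhds (x - y)) := by
    intro α β x y hα hβ
    simpa [sub_smul, Finset.sum_sub_distrib] using hα.sub hβ
  refine existsUnique_of_exists_of_unique ?_ fun α β hα hβ => ?_
  · obtain ⟨x, hx, hxv⟩ := mem_closure_iff_seq_limit.mp hv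
    choose a ha using fun k => exists_eventually_eq_sum_range_of_mem_span (hx k)
    have hat : ∀ k, Tendsto (fun N => ∑ j ∈ Finset.range N, a k j • e j) atTop (nhds (x k)) :=
      fun k => tendsto_const_nhds.congr' ((ha k).mono fun _ h => h.symm)
    have hcauchy : ∀ j, CauchySeq fun k => a k j := by
      intro j
      have hx0 : Tendsto (fun q : ℕ × ℕ => 2 * K / ‖e j‖ * dist (x q.1) (x q.2)) atTop (nhds 0) := by
        simpa using (cauchySeq_iff_tendsto_dist_atTop_0.mp hxv.cauchySeq).const_mul
          (2 * K / ‖e j‖)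
      rw [cauchySeq_iff_tendsto_dist_atTop_0]
      refine squeeze_zero (fun _ => dist_nonneg) (fun q => ?_) hx0
      have := norm_coeff_mul_norm_le_of_tendsto hK (sub_tendsto (hat q.1) (hat q.2)) j
      rw [dist_eq_norm, dist_eq_norm, div_mul_eq_mul_div, le_div_iff₀ (norm_pos_iff.mpr (he j))]
      exact this
    choose α hα using fun j => cauchySeq_tendsto_of_complete (hcauchy j)
    have hsum : ∀ m, Tendsto (fun k => ∑ j ∈ Finset.range m, a k j • e j) atTop
        (nhds (∑ j ∈ Finset.range m, α j • e j)) := fun m =>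
      tendsto_finsetSum _ fun j _ => (hα j).smul_const (e j)
    have hdiff : ∀ k m, ‖∑ j ∈ Finset.range m, a k j • e j - ∑ j ∈ Finset.range m, α j • e j‖ ≤
        K * ‖x k - v‖ := by
      intro k m
      refine le_of_tendsto_of_tendsto' ((tendsto_const_nhds.sub (hsum m)).norm)
        (((tendsto_const_nhds.sub hxv).norm).const_mul K) fun i => ?_
      simpa [sub_smul, Finset.sum_sub_distrib] using
        norm_sum_range_le_of_tendsto hK (sub_tendsto (hat k) (hat i)) m
    refine ⟨α, Metric.tendsto_atTop'.mpr fun ε hε => ?_⟩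
    have hlim : Tendsto (fun k => (K + 1) * ‖x k - v‖) atTop (nhds 0) := by
      simpa using (tendsto_iff_norm_sub_tendsto_zero.mp hxv).const_mul (K + 1)
    obtain ⟨k, hk⟩ := (hlim.eventually_lt_const hε).exists
    obtain ⟨N, hN⟩ := eventually_atTop.mp (ha k)
    refine ⟨N, fun m hm => ?_⟩
    have h1 := hdiff k m
    rw [hN m hm.le] at h1
    rw [dist_eq_norm]
    have h2 := norm_sub_le_norm_sub_add_norm_sub (∑ j ∈ Finset.range m, α j • e j) (x k) v
    rw [norm_sub_rev _ (x k)] at h2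
    linarith
  · funext j
    have := norm_coeff_mul_norm_le_of_tendsto hK (sub_tendsto hα hβ) j
    rw [sub_self, norm_zero, mul_zero] at this
    have hpos : 0 < ‖e j‖ := norm_pos_iff.mpr (he j)
    have h0 : ‖(α - β) j‖ = 0 := by nlinarith [norm_nonneg ((α - β) j)]
    exact sub_eq_zero.mp (norm_eq_zero.mp h0)

end Basis

/-- If `(e_j)` is a sequence of nonzero elements of a C*-algebra `A` and `K ≥ 1` is such that
`‖∑_{j=1}^m u_j ⊗ e_j‖_{Mₙ(A)} ≤ K ‖∑_{j=1}^l u_j ⊗ e_j‖_{Mₙ(A)}` for all `n`, all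
`l ≥ m ≥ 1` and all scalar matrices `u_j ∈ Mₙ(ℂ)`, then `(e_j)` is a Schauder basis of the
closed linear span `E` of the `e_j`, whose basis projections `P_m` are completely bounded
with cb-norm at most `K` (on matrices with entries in `E`).  Here `mnorm n` denotes the
(necessarily unique) C*-norm on `Mₙ(A)`, characterized by the listed axioms. -/
theorem cbBasicSequence_of_matrix_dominated
    {A : Type*} [NonUnitalCStarAlgebra A] [StarModule ℂ A]
    (mnorm : ∀ n : ℕ, Matrix (Fin n) (Fin n) A → ℝ)
    (mnorm_add : ∀ n (x y : Matrix (Fin n) (Fin n) A),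
      mnorm n (x + y) ≤ mnorm n x + mnorm n y)
    (mnorm_smul : ∀ n (c : ℂ) (x : Matrix (Fin n) (Fin n) A),
      mnorm n (c • x) = ‖c‖ * mnorm n x)
    (mnorm_mul : ∀ n (x y : Matrix (Fin n) (Fin n) A),
      mnorm n (x * y) ≤ mnorm n x * mnorm n y)
    (mnorm_star_mul_self : ∀ n (x : Matrix (Fin n) (Fin n) A),
      mnorm n (star x * x) = mnorm n x ^ 2)
    (mnorm_pos : ∀ n (x : Matrix (Fin n) (Fin n) A), x ≠ 0 → 0 < mnorm n x)
    (mnorm_one : ∀ a : A, mnorm 1 (Matrix.of fun _ _ => a) = ‖a‖)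
    (e : ℕ → A) (he : ∀ j, e j ≠ 0)
    (K : ℝ) (hK1 : 1 ≤ K)
    (hK : ∀ (n : ℕ) (u : ℕ → Matrix (Fin n) (Fin n) ℂ) (m l : ℕ), 1 ≤ m → m ≤ l →
      mnorm n (∑ j ∈ Finset.range m, Matrix.of fun p q => u j p q • e j) ≤
        K * mnorm n (∑ j ∈ Finset.range l, Matrix.of fun p q => u j p q • e j)) :
    -- `(e_j)` is a Schauder basis of the closed linear span of the `e_j`
    (∀ v : A, v ∈ (Submodule.span ℂ (Set.range e)).topologicalClosure →
      ∃! α : ℕ → ℂ,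
        Tendsto (fun N => ∑ j ∈ Finset.range N, α j • e j) atTop (nhds v)) ∧
    -- and its basis projections are completely bounded with cb-norm at most `K`
    (∀ (n : ℕ) (v : Matrix (Fin n) (Fin n) A) (α : Fin n → Fin n → ℕ → ℂ),
      (∀ p q, Tendsto (fun N => ∑ j ∈ Finset.range N, α p q j • e j) atTop (nhds (v p q))) →
      ∀ m : ℕ,
        mnorm n (Matrix.of fun p q => ∑ j ∈ Finset.range m, α p q j • e j) ≤
          K * mnorm n v) := by
  let p : ∀ n, Seminorm ℂ (Matrix (Fin n) (Fin n) A) := fun n =>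
    Seminorm.of (mnorm n) (mnorm_add n) (mnorm_smul n)
  have hzero : ∀ n, mnorm n 0 = 0 := fun n => map_zero (p n)
  have hnonneg : ∀ n x, 0 ≤ mnorm n x := fun n => apply_nonneg (p n)
  have hK' : ∀ (n : ℕ) (u : ℕ → Matrix (Fin n) (Fin n) ℂ) (m l : ℕ), m ≤ l →
      mnorm n (∑ j ∈ Finset.range m, Matrix.of fun p q => u j p q • e j) ≤
        K * mnorm n (∑ j ∈ Finset.range l, Matrix.of fun p q => u j p q • e j) := by
    intro n u m l hml
    rcases Nat.eq_zero_or_pos m with rfl | hm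
    · rw [Finset.range_zero, Finset.sum_empty, hzero]
      exact mul_nonneg (zero_le_one.trans hK1) (hnonneg n _)
    · exact hK n u m l hm hml
  have hof : ∀ (n : ℕ) (α : Fin n → Fin n → ℕ → ℂ) (m : ℕ),
      (Matrix.of fun p q => ∑ j ∈ Finset.range m, α p q j • e j) =
        ∑ j ∈ Finset.range m, Matrix.of fun p q =>
          (Matrix.of fun p q => α p q j : Matrix (Fin n) (Fin n) ℂ) p q • e j := by
    intro n α m
    ext p q
    simp [Matrix.sum_apply]
  refine ⟨fun v hv => existsUnique_tendsto_sum_range_of_norm_le (K := K) he ?_ hv, ?_⟩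
  · intro α m l hml
    have := hK' 1 (fun j => Matrix.of fun _ _ => α j) m l hml
    rw [← hof 1 (fun _ _ => α), ← hof 1 (fun _ _ => α), mnorm_one, mnorm_one] at this
    exact this
  · intro n v α hα m
    have hlim : Tendsto (fun N => mnorm n (Matrix.of fun p q => ∑ j ∈ Finset.range N, α p q j • e j))
        atTop (nhds (mnorm n v)) :=
      (p n).tendsto_of_star_mul_self (mnorm_star_mul_self n) hα
    refine ge_of_tendsto (hlim.const_mul K) ((eventually_ge_atTop m).mono fun l hl => ?_)
    rw [hof, hof]
    exact hK' n _ m l hl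
end

section
/- Let A be a C*-algebra which has a cb-basis: a Schauder basis (x_i) of A whose basis projections P_m (P_m(∑_i α_i x_i) = ∑_{i=1}^m α_i x_i) satisfy sup_m ‖P_m‖_cb < ∞. Then every infinite-dimensional closed subspace Y of A contains a cb-basic sequence; that is, there exist a sequence (y_j) of norm-one elements of Y and a constant K ≥ 1 such that for all integers n ≥ 1, all l ≥ m ≥ 1, and all u_1, …, u_l ∈ M_n(ℂ): ‖∑_{j=1}^m u_j ⊗ y_j‖_{M_n(A)} ≤ K·‖∑_{j=1}^l u_j ⊗ y_j‖_{M_n(A)}. -/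
open Filter

/-- A C*-norm on a complex *-algebra, not assumed to be complete. -/
structure IsCStarNorm {R : Type*} [NonUnitalRing R] [StarRing R] [Module ℂ R]
    (N : Seminorm ℂ R) : Prop where
  mul_le : ∀ x y, N (x * y) ≤ N x * N y
  star_mul_self : ∀ x, N (star x * x) = N x ^ 2
  pos : ∀ x, x ≠ 0 → 0 < N x

namespace IsCStarNorm

section General

variable {R : Type*} [NonUnitalRing R] [StarRing R] [Module ℂ R] {N : Seminorm ℂ R}

theorem le_star (hN : IsCStarNorm N) (x : R) : N x ≤ N (star x) := by
  rcases (apply_nonneg N x).eq_or_lt with h | h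
  · rw [← h]; exact apply_nonneg N _
  · have h1 := hN.mul_le (star x) x
    rw [hN.star_mul_self, sq] at h1
    exact le_of_mul_le_mul_right h1 h

theorem star_eq (hN : IsCStarNorm N) (x : R) : N (star x) = N x :=
  le_antisymm (by simpa using hN.le_star (star x)) (hN.le_star x)

theorem self_mul_star (hN : IsCStarNorm N) (x : R) : N (x * star x) = N x ^ 2 := by
  simpa [hN.star_eq] using hN.star_mul_self (star x)

theorem eq_of_star_mul_self_eq (hN : IsCStarNorm N) {x y : R}
    (h : star x * x = star y * y) : N x = N y := by
  have h1 : N x ^ 2 = N y ^ 2 := by rw [← hN.star_mul_self, ← hN.star_mul_self, h]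
  exact (sq_eq_sq₀ (apply_nonneg N x) (apply_nonneg N y)).1 h1

end General

/-- A C*-norm on a C*-algebra which is dominated by twice the original norm also
dominates half of it. -/
theorem norm_le_two_mul {A : Type*} [NonUnitalCStarAlgebra A] {N : Seminorm ℂ A}
    (hN : IsCStarNorm N) (hle : ∀ a, N a ≤ 2 * ‖a‖) (a : A) : ‖a‖ ≤ 2 * N a := by
  rcases eq_or_ne a 0 with rfl | ha
  · simp
  set p : A := star a * a with hp
  have hsa : IsSelfAdjoint p := IsSelfAdjoint.star_mul_self a
  have hpn : ‖p‖ = ‖a‖ ^ 2 := by rw [hp, CStarRing.norm_star_mul_self, sq]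
  have ht : 0 < ‖p‖ := by rw [hpn]; have := norm_pos_iff.2 ha; positivity
  set t := ‖p‖ with ht_def
  let g : ℝ → ℝ := fun s => max (|s| - t / 2) 0
  let r : ℝ → ℝ := fun s => s / max |s| (t / 2) ^ 2
  have hmax : ∀ s : ℝ, 0 < max |s| (t / 2) := fun s => lt_max_of_lt_right (by positivity)
  have hg : Continuous g := by fun_prop
  have hr : Continuous r :=
    continuous_id.div (by fun_prop) fun s => (pow_pos (hmax s) 2).ne'
  have hg0 : g 0 = 0 := by simp [g]; positivity
  have hr0 : r 0 = 0 := by simp [r]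
  have hrg : ∀ s, r s * (s * g s) = g s := by
    intro s
    rcases le_total |s| (t / 2) with h | h
    · simp [g, h]
    · have hs : s ≠ 0 := by rintro rfl; simp at h; linarith
      simp only [r, max_eq_left h, sq_abs]
      field_simp
  have hb : cfcₙ g p ≠ 0 := by
    intro hb
    have h1 : ‖cfcₙ (id : ℝ → ℝ) p‖ ≤ t / 2 := by
      refine norm_cfcₙ_le fun s hs => ?_
      have h2 := norm_apply_le_norm_cfcₙ g p hs hg.continuousOn hg0 hsa
      rw [hb, norm_zero, norm_le_zero_iff] at h2
      have h3 : |s| - t / 2 ≤ g s := le_max_left _ _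
      simp only [id, Real.norm_eq_abs]
      linarith
    rw [cfcₙ_id ℝ p hsa] at h1
    linarith
  have hmul : cfcₙ g p = cfcₙ r p * (p * cfcₙ g p) := by
    conv_rhs => rw [show p * cfcₙ g p = cfcₙ (fun s => s * g s) p by
      rw [cfcₙ_mul (fun s : ℝ => s) g p (by fun_prop) rfl hg.continuousOn hg0,
        cfcₙ_id' ℝ p hsa]]
    rw [← cfcₙ_mul r _ p hr.continuousOn hr0 (by fun_prop) (by simp)]
    exact cfcₙ_congr fun s _ => (hrg s).symm
  have hrn : ‖cfcₙ r p‖ ≤ 2 / t := by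
    refine norm_cfcₙ_le fun s _ => ?_
    simp only [r, norm_div, Real.norm_eq_abs, abs_pow, abs_of_pos (hmax s)]
    rw [div_le_div_iff₀ (pow_pos (hmax s) 2) ht]
    have h1 := le_max_left |s| (t / 2)
    have h2 := le_max_right |s| (t / 2)
    nlinarith [abs_nonneg s]
  have hbpos := hN.pos _ hb
  have h1 : N (cfcₙ g p) ≤ 2 * (2 / t) * (N p * N (cfcₙ g p)) := by
    calc N (cfcₙ g p) = N (cfcₙ r p * (p * cfcₙ g p)) := by rw [← hmul]
      _ ≤ N (cfcₙ r p) * N (p * cfcₙ g p) := hN.mul_le _ _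
      _ ≤ _ := mul_le_mul ((hle _).trans (by gcongr)) (hN.mul_le _ _) (apply_nonneg _ _)
        (by positivity)
  have h2 : 1 ≤ 2 * (2 / t) * N p :=
    le_of_mul_le_mul_right (by rw [one_mul]; linarith) hbpos
  have h3 : t ≤ 4 * N p := by
    have : 2 * (2 / t) * N p = 4 * N p / t := by ring
    rwa [this, one_le_div ht] at h2
  rw [hpn, hp, hN.star_mul_self] at h3
  have h4 : ‖a‖ ^ 2 ≤ (2 * N a) ^ 2 := by linarith
  exact (sq_le_sq₀ (norm_nonneg _) (by have := apply_nonneg N a; positivity)).1 h4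

end IsCStarNorm

theorem Seminorm.le_two_mul_of_unitary {B E : Type*} [CStarAlgebra B] [AddCommGroup E]
    [Module ℂ E] (N : Seminorm ℂ E) (L : B →ₗ[ℂ] E) {c : ℝ}
    (h : ∀ v : unitary B, N (L v) ≤ c) (b : B) : N (L b) ≤ 2 * ‖b‖ * c := by
  obtain ⟨v, d, hb, hd⟩ := CStarAlgebra.exists_sum_four_unitary b
  calc N (L b) = N (∑ i, d i • L (v i)) := by
        conv_lhs => rw [hb]
        simp only [map_sum, map_smul]
    _ ≤ ∑ i, N (d i • L (v i)) := Finset.le_sum_of_subadditive N (map_zero N).le (map_add_le_add N) _ _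
    _ ≤ ∑ _i : Fin 4, ‖b‖ / 2 * c := by
        refine Finset.sum_le_sum fun i _ => ?_
        rw [map_smul_eq_mul]
        exact mul_le_mul (hd i) (h _) (apply_nonneg _ _) (by positivity)
    _ = 2 * ‖b‖ * c := by simp; ring

section Matrices

open scoped Matrix.Norms.L2Operator

variable {n : Type*} [Fintype n] [DecidableEq n] {A : Type*} [NonUnitalCStarAlgebra A]

/-- The elementary tensor `u ⊗ y`, as a linear function of `y`. -/
def Matrix.tens (u : Matrix n n ℂ) : A →ₗ[ℂ] Matrix n n A where
  toFun y := Matrix.of fun p q => u p q • y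
  map_add' y z := by ext; simp
  map_smul' c y := by ext p q; exact smul_comm _ _ _

open Matrix

omit [Fintype n] [DecidableEq n] in
@[simp]
theorem Matrix.tens_apply (u : Matrix n n ℂ) (y : A) (p q : n) : tens u y p q = u p q • y := rfl

omit [DecidableEq n] in
theorem Matrix.tens_mul_tens (u v : Matrix n n ℂ) (y z : A) :
    tens u y * tens v z = tens (u * v) (y * z) := by
  ext p q
  simp [Matrix.mul_apply, Finset.sum_smul, smul_mul_smul_comm]

omit [Fintype n] [DecidableEq n] in
theorem Matrix.star_tens (u : Matrix n n ℂ) (y : A) : star (tens u y) = tens (star u) (star y) := by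
  ext p q
  simp [Matrix.star_apply]

omit [Fintype n] [DecidableEq n] in
theorem Matrix.tens_smul (c : ℂ) (u : Matrix n n ℂ) (y : A) : tens (c • u) y = c • tens u y := by
  ext p q
  simp [mul_smul]

theorem Matrix.star_mul_self_eq_of_map_inr {X Z : Matrix n n A}
    {V : Matrix n n (Unitization ℂ A)} (hV : star V * V = 1)
    (h : Z.map (Unitization.inr : A → Unitization ℂ A) = V * X.map Unitization.inr) :
    star Z * Z = star X * X := by
  have hinj : Function.Injective
      (fun M : Matrix n n A => M.map (Unitization.inr : A → Unitization ℂ A)) :=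
    Matrix.map_injective Unitization.inr_injective
  have key : ∀ M : Matrix n n A, (star M * M).map (Unitization.inr : A → Unitization ℂ A)
      = star (M.map Unitization.inr) * M.map Unitization.inr := by
    intro M
    ext1 p q
    have := map_sum (Unitization.inrNonUnitalStarAlgHom ℂ A) (fun j => star (M j p) * M j q)
      Finset.univ
    simp only [Unitization.inrNonUnitalStarAlgHom_apply, Unitization.inr_mul,
      Unitization.inr_star] at this
    simpa [Matrix.mul_apply, Matrix.star_apply] using this
  apply hinj
  simp only [key, h, star_mul]
  rw [mul_assoc, ← mul_assoc (star V), hV, one_mul]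

/-- Left multiplication of a matrix by elements of the unitization, entrywise. -/
def Matrix.unitizationAct (X : Matrix n n A) : Unitization ℂ A →ₗ[ℂ] Matrix n n A where
  toFun b := X.map fun a => b.fst • a + b.snd * a
  map_add' b c := by ext; simp [add_smul, add_mul]; abel
  map_smul' c b := by ext; simp [mul_smul, smul_mul_assoc]

/-- Left multiplication of a matrix over `A` by scalar matrices. -/
def Matrix.scalarAct (X : Matrix n n A) : Matrix n n ℂ →ₗ[ℂ] Matrix n n A where
  toFun u := Matrix.of fun p q => ∑ r, u p r • X r q
  map_add' b c := by ext; simp [add_smul, Finset.sum_add_distrib]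
  map_smul' c b := by ext; simp [mul_smul, Finset.smul_sum]

omit [Fintype n] [DecidableEq n] in
theorem Matrix.unitizationAct_tens (u : Matrix n n ℂ) (a y : A) :
    unitizationAct (tens u y) (a : Unitization ℂ A) = tens u (a * y) := by
  ext p q
  simp [unitizationAct, mul_smul_comm]

omit [DecidableEq n] in
theorem Matrix.scalarAct_tens (u v : Matrix n n ℂ) (y : A) :
    scalarAct (tens v y) u = tens (u * v) y := by
  ext p q
  simp [scalarAct, Matrix.mul_apply, Finset.sum_smul, mul_smul]

variable {N : Seminorm ℂ (Matrix n n A)}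

theorem IsCStarNorm.unitizationAct_le (hN : IsCStarNorm N) (X : Matrix n n A)
    (b : Unitization ℂ A) : N (unitizationAct X b) ≤ 2 * ‖b‖ * N X := by
  refine N.le_two_mul_of_unitary (unitizationAct X) (fun v => le_of_eq ?_) b
  refine hN.eq_of_star_mul_self_eq
    (star_mul_self_eq_of_map_inr (V := diagonal fun _ => (v : Unitization ℂ A)) ?_ ?_)
  · rw [star_eq_conjTranspose, diagonal_conjTranspose, diagonal_mul_diagonal]
    simp [← diagonal_one]
  · ext1 p q
    rw [diagonal_mul]
    ext <;> simp [unitizationAct]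

theorem IsCStarNorm.scalarAct_le (hN : IsCStarNorm N) (X : Matrix n n A)
    (u : Matrix n n ℂ) : N (scalarAct X u) ≤ 2 * ‖u‖ * N X := by
  refine N.le_two_mul_of_unitary (scalarAct X) (fun v => le_of_eq ?_) u
  refine hN.eq_of_star_mul_self_eq
    (star_mul_self_eq_of_map_inr
      (V := (v : Matrix n n ℂ).map (algebraMap ℂ (Unitization ℂ A))) ?_ ?_)
  · have h1 : star (v : Matrix n n ℂ) * v = 1 := Unitary.coe_star_mul_self v
    have h2 : star ((v : Matrix n n ℂ).map (algebraMap ℂ (Unitization ℂ A))) =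
        (star (v : Matrix n n ℂ)).map (algebraMap ℂ (Unitization ℂ A)) := by
      ext1 p q
      simpa [Matrix.star_apply] using (algebraMap_star_comm (A := Unitization ℂ A) ((v : Matrix n n ℂ) q p)).symm
    rw [h2, ← Matrix.map_mul, h1, Matrix.map_one _ (map_zero _) (map_one _)]
  · ext1 p q
    have := map_sum (Unitization.inrNonUnitalStarAlgHom ℂ A)
      (fun r => (v : Matrix n n ℂ) p r • X r q) Finset.univ
    simp only [Unitization.inrNonUnitalStarAlgHom_apply] at this
    simp [scalarAct, Matrix.mul_apply, this, Unitization.algebraMap_eq_inl_comp,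
      Unitization.inl_mul_inr]

theorem IsCStarNorm.tens_le_of_projection (hN : IsCStarNorm N) {e : Matrix n n ℂ}
    (he : star e * e = e) (y : A) : N (tens e y) ≤ 2 * ‖y‖ := by
  rcases (apply_nonneg N (tens e y)).eq_or_lt with h | h
  · rw [← h]; positivity
  · refine le_of_mul_le_mul_right ?_ h
    have h1 := hN.unitizationAct_le (tens e y) ((star y : A) : Unitization ℂ A)
    rw [unitizationAct_tens, Unitization.norm_inr, norm_star] at h1
    rwa [← sq, ← hN.star_mul_self, star_tens, tens_mul_tens, he]

theorem IsCStarNorm.norm_le_tens_of_projection (hN : IsCStarNorm N) {e : Matrix n n ℂ}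
    (he : star e * e = e) (he' : star e = e) (h0 : e ≠ 0) (y : A) :
    ‖y‖ ≤ 2 * N (tens e y) := by
  have h : IsCStarNorm (N.comp (tens e : A →ₗ[ℂ] Matrix n n A)) := by
    refine ⟨fun x y => ?_, fun x => ?_, fun x hx => hN.pos _ fun h => ?_⟩
    · simp only [Seminorm.comp_apply]
      have := hN.mul_le (tens e x) (tens e y)
      rwa [tens_mul_tens, show e * e = e by simpa only [he'] using he] at this
    · simp only [Seminorm.comp_apply]
      rw [← hN.star_mul_self, star_tens, tens_mul_tens, he]
    · apply h0
      ext p q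
      have := congrFun (congrFun h p) q
      simpa [hx] using this
  exact h.norm_le_two_mul (hN.tens_le_of_projection he) y

theorem IsCStarNorm.tens_le (hN : IsCStarNorm N) (u : Matrix n n ℂ) (y : A) :
    N (tens u y) ≤ 4 * ‖u‖ * ‖y‖ := by
  have h1 := hN.scalarAct_le (tens 1 y) u
  rw [scalarAct_tens, mul_one] at h1
  have h2 := hN.tens_le_of_projection (e := (1 : Matrix n n ℂ)) (by simp) y
  nlinarith [norm_nonneg u]

theorem IsCStarNorm.norm_mul_norm_le_tens (hN : IsCStarNorm N) (u : Matrix n n ℂ) (y : A) :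
    ‖u‖ * ‖y‖ ≤ 4 * N (tens u y) := by
  rcases isEmpty_or_nonempty n with hn | ⟨⟨i⟩⟩
  · rw [Subsingleton.elim u 0, norm_zero, zero_mul]
    have := apply_nonneg N (tens (0 : Matrix n n ℂ) y)
    positivity
  set e : Matrix n n ℂ := single i i 1 with he_def
  have he' : star e = e := by simp [he_def, star_eq_conjTranspose]
  have he : star e * e = e := by rw [he']; simp [he_def]
  have h0 : e ≠ 0 := by
    intro h
    simpa [he_def] using congrFun (congrFun h i) i
  have hen : ‖e‖ ≤ 1 := by
    have := CStarRing.norm_star_mul_self (x := e)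
    rw [he] at this
    nlinarith [norm_nonneg e, sq_nonneg (‖e‖ - 1)]
  have row : ∀ w : EuclideanSpace ℂ n,
      (of fun p q => if p = i then star (w q) else 0 : Matrix n n ℂ) *
        star (of fun p q => if p = i then star (w q) else 0 : Matrix n n ℂ)
        = ((‖w‖ ^ 2 : ℝ) : ℂ) • e := by
    intro w
    ext p q
    simp only [mul_apply, star_apply, of_apply, Matrix.smul_apply, he_def, single_apply,
      smul_eq_mul, eq_comm (a := i)]
    by_cases hp : p = i <;> by_cases hq : q = i <;>
      simp [hp, hq, EuclideanSpace.norm_sq_eq, Complex.conj_mul']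
  have bound : ∀ w : EuclideanSpace ℂ n,
      ‖toEuclideanCLM (n := n) (𝕜 := ℂ) (star u) w‖ * N (tens e y)
        ≤ 2 * ‖w‖ * N (tens u y) := by
    intro w
    set q : Matrix n n ℂ := of fun p q => if p = i then star (w q) else 0 with hq
    set w' := toEuclideanCLM (n := n) (𝕜 := ℂ) (star u) w with hw'
    have hqn : ‖q‖ ≤ ‖w‖ := by
      refine (sq_le_sq₀ (norm_nonneg _) (norm_nonneg _)).1 ?_
      rw [sq, ← CStarRing.norm_self_mul_star, row w, norm_smul, Complex.norm_real,
        Real.norm_of_nonneg (by positivity)]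
      exact mul_le_of_le_one_right (by positivity) hen
    have hqu : q * u = of fun p q => if p = i then star (w' q) else 0 := by
      ext p k
      by_cases hp : p = i
      · simp [hq, hp, mul_apply, hw', mulVec, dotProduct, star_apply, mul_comm]
      · simp [hq, hp, mul_apply]
    have h1 := hN.scalarAct_le (tens u y) q
    rw [scalarAct_tens] at h1
    have h2 : N (tens (q * u) y) ^ 2 = (‖w'‖ * N (tens e y)) ^ 2 := by
      rw [← hN.self_mul_star, star_tens, tens_mul_tens, hqu, row w', tens_smul, map_smul_eq_mul,
        Complex.norm_real, Real.norm_of_nonneg (by positivity), mul_pow, ← hN.self_mul_star,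
        star_tens, tens_mul_tens, he', show e * e = e by simpa only [he'] using he]
    rw [sq_eq_sq₀ (apply_nonneg _ _) (mul_nonneg (norm_nonneg _) (apply_nonneg _ _))] at h2
    rw [← h2]
    refine h1.trans ?_
    have := apply_nonneg N (tens u y)
    gcongr
  have hu : ‖u‖ * N (tens e y) ≤ 2 * N (tens u y) := by
    rcases (apply_nonneg N (tens e y)).eq_or_lt with h | h
    · rw [← h, mul_zero]
      have := apply_nonneg N (tens u y)
      positivity
    · rw [← le_div_iff₀ h, ← norm_star, cstar_norm_def]
      refine ContinuousLinearMap.opNorm_le_bound _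
        (div_nonneg (mul_nonneg zero_le_two (apply_nonneg _ _)) h.le) fun w => ?_
      rw [div_mul_eq_mul_div, le_div_iff₀ h]
      have := bound w
      linarith
  have hy := hN.norm_le_tens_of_projection he he' h0 y
  nlinarith [norm_nonneg u]

theorem IsCStarNorm.tens_mul_norm_le (hN : IsCStarNorm N) (u : Matrix n n ℂ) (y z : A) :
    N (tens u y) * ‖z‖ ≤ 16 * ‖y‖ * N (tens u z) := by
  have h1 := hN.tens_le u y
  have h2 := hN.norm_mul_norm_le_tens u z
  nlinarith [norm_nonneg z, norm_nonneg y]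

end Matrices

section Basis

variable {E : Type*} [NormedAddCommGroup E] [NormedSpace ℂ E]

/-- The basis projections of a Schauder basis. -/
theorem exists_basis_projections (x : ℕ → E)
    (hbasis : ∀ v : E, ∃! α : ℕ → ℂ,
      Tendsto (fun N => ∑ i ∈ Finset.range N, α i • x i) atTop (nhds v)) :
    ∃ (α : E → ℕ → ℂ) (P : ℕ → E →ₗ[ℂ] E),
      (∀ m v, P m v = ∑ i ∈ Finset.range m, α v i • x i) ∧
      (∀ v, Tendsto (fun m => P m v) atTop (nhds v)) ∧
      (∀ m k v, P m (P k v) = P (min m k) v) ∧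
      ∀ m, FiniteDimensional ℂ (P m).range := by
  choose α hα huniq using hbasis
  have hadd : ∀ v w, α (v + w) = α v + α w := fun v w => by
    refine (huniq _ _ ?_).symm
    simpa [add_smul, Finset.sum_add_distrib] using (hα v).add (hα w)
  have hsmul : ∀ (c : ℂ) v, α (c • v) = c • α v := fun c v => by
    refine (huniq _ _ ?_).symm
    simpa [mul_smul, Finset.smul_sum] using (hα v).const_smul c
  let P : ℕ → E →ₗ[ℂ] E := fun m =>
    { toFun := fun v => ∑ i ∈ Finset.range m, α v i • x i
      map_add' := fun v w => by simp [hadd, add_smul, Finset.sum_add_distrib]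
      map_smul' := fun c v => by simp [hsmul, mul_smul, Finset.smul_sum] }
  have hP : ∀ m v, P m v = ∑ i ∈ Finset.range m, α v i • x i := fun _ _ => rfl
  have hsum : ∀ (v : E) (m k : ℕ),
      ∑ i ∈ Finset.range m, (if i < k then α v i else 0) • x i = P (min m k) v := by
    intro v m k
    simp only [ite_smul, zero_smul, hP]
    rw [← Finset.sum_filter]
    congr 1
    ext i
    simp
  refine ⟨α, P, hP, hα, fun m k v => ?_, fun m => ?_⟩
  · have h : α (P k v) = fun i => if i < k then α v i else 0 := by
      refine (huniq _ _ ?_).symm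
      refine tendsto_const_nhds.congr' ?_
      filter_upwards [eventually_ge_atTop k] with m hm
      rw [hsum, min_eq_right hm]
    rw [hP m, h, hsum]
  · have : FiniteDimensional ℂ (Submodule.span ℂ (x '' Finset.range m)) :=
      FiniteDimensional.span_of_finite ℂ ((Finset.finite_toSet _).image x)
    refine Submodule.finiteDimensional_of_le (S₂ := Submodule.span ℂ (x '' Finset.range m)) ?_
    rintro _ ⟨v, rfl⟩
    rw [hP]
    exact Submodule.sum_mem _ fun i hi =>
      Submodule.smul_mem _ _ (Submodule.subset_span ⟨i, hi, rfl⟩)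

/-- In an infinite-dimensional subspace there are unit vectors killed by a given
finite-rank map. -/
theorem Submodule.exists_norm_eq_one_of_finite_range (Y : Submodule ℂ E)
    (hY : ¬ FiniteDimensional ℂ Y) (T : E →ₗ[ℂ] E) [FiniteDimensional ℂ T.range] :
    ∃ y ∈ Y, ‖y‖ = 1 ∧ T y = 0 := by
  have h : ¬ Function.Injective (T.rangeRestrict ∘ₗ Y.subtype) := fun h =>
    hY (FiniteDimensional.of_injective _ h)
  rw [← LinearMap.ker_eq_bot, Submodule.eq_bot_iff] at h
  push Not at h
  obtain ⟨v, hv, hv0⟩ := h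
  have hTv : T v = 0 := by simpa using congrArg Subtype.val (LinearMap.mem_ker.1 hv)
  have hv0' : (v : E) ≠ 0 := by simpa using hv0
  refine ⟨((‖(v : E)‖⁻¹ : ℝ) : ℂ) • (v : E), Y.smul_mem _ v.2, ?_, by simp [hTv]⟩
  simp [norm_smul, hv0']

/-- The gliding hump: unit vectors in an infinite-dimensional subspace which are arbitrarily
good perturbations of blocks with respect to a sequence of commuting projections. -/
theorem Submodule.exists_almost_block_sequence (Y : Submodule ℂ E)
    (hY : ¬ FiniteDimensional ℂ Y) (P : ℕ → E →ₗ[ℂ] E)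
    (hP : ∀ v, Tendsto (fun m => P m v) atTop (nhds v))
    (hfin : ∀ m, FiniteDimensional ℂ (P m).range) (ε : ℕ → ℝ) (hε : ∀ j, 0 < ε j) :
    ∃ (y : ℕ → E) (k : ℕ → ℕ), Monotone k ∧ ∀ j, y j ∈ Y ∧ ‖y j‖ = 1 ∧
      P (k j) (y j) = 0 ∧ ‖y j - P (k (j + 1)) (y j)‖ ≤ ε j := by
  have step : ∀ j k : ℕ, ∃ (y : E) (k' : ℕ), k ≤ k' ∧ y ∈ Y ∧ ‖y‖ = 1 ∧ P k y = 0 ∧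
      ‖y - P k' y‖ ≤ ε j := by
    intro j k
    obtain ⟨y, hyY, hy1, hy0⟩ := Y.exists_norm_eq_one_of_finite_range hY (P k)
    obtain ⟨k', hk', hkk'⟩ := (((Metric.tendsto_nhds.1 (hP y)) (ε j) (hε j)).and
      (eventually_ge_atTop k)).exists
    exact ⟨y, k', hkk', hyY, hy1, hy0, by rw [← dist_eq_norm, dist_comm]; exact hk'.le⟩
  choose F G hG hF using step
  let k : ℕ → ℕ := fun j => Nat.rec 0 (fun j k => G j k) j
  exact ⟨fun j => F j (k j), k, monotone_nat_of_le_succ fun j => hG j (k j),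
    fun j => hF j (k j)⟩

end Basis

/-- The perturbation estimate behind the principle of small perturbations. -/
theorem Seminorm.sum_perturbation_le {M : Type*} [AddCommGroup M] [Module ℂ M]
    (N : Seminorm ℂ M) {C : ℝ} (hC : 1 ≤ C) {a b : ℕ → M} {l m : ℕ} (hml : m ≤ l)
    (ha : ∀ i ≤ l, N (∑ j ∈ Finset.range i, a j) ≤ C * N (∑ j ∈ Finset.range l, a j))
    (hb : ∀ j < l, N (b j - a j) ≤ (1 / 2) ^ (j + 2) / (2 * C) * N (a j)) :
    N (∑ j ∈ Finset.range m, b j) ≤ (2 * C + 1) * N (∑ j ∈ Finset.range l, b j) := by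
  set S := N (∑ j ∈ Finset.range l, a j) with hS
  have hC0 : 0 < C := by linarith
  have hS0 : 0 ≤ S := apply_nonneg _ _
  have hterm : ∀ j < l, N (b j - a j) ≤ (1 / 2) ^ (j + 2) * S := by
    intro j hj
    have h1 : N (a j) ≤ 2 * C * S := by
      have h2 : a j = ∑ i ∈ Finset.range (j + 1), a i - ∑ i ∈ Finset.range j, a i := by
        rw [Finset.sum_range_succ]; abel
      rw [h2]
      have := map_sub_le_add N (∑ i ∈ Finset.range (j + 1), a i) (∑ i ∈ Finset.range j, a i)
      linarith [ha (j + 1) hj, ha j hj.le]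
    refine (hb j hj).trans ?_
    calc _ ≤ (1 / 2) ^ (j + 2) / (2 * C) * (2 * C * S) := by gcongr
      _ = _ := by field_simp
  have hdiff : ∀ i ≤ l,
      N (∑ j ∈ Finset.range i, b j - ∑ j ∈ Finset.range i, a j) ≤ 1 / 2 * S := by
    intro i hi
    have hgeom : ∑ j ∈ Finset.range i, (1 / 2 : ℝ) ^ (j + 2) ≤ 1 / 2 := by
      have := sum_geometric_two_le i
      simp only [pow_add, ← Finset.sum_mul]
      linarith
    rw [← Finset.sum_sub_distrib]
    calc N (∑ j ∈ Finset.range i, (b j - a j))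
        ≤ ∑ j ∈ Finset.range i, N (b j - a j) :=
          Finset.le_sum_of_subadditive N (map_zero N).le (map_add_le_add N) _ _
      _ ≤ ∑ j ∈ Finset.range i, (1 / 2) ^ (j + 2) * S := Finset.sum_le_sum fun j hj =>
          hterm j ((Finset.mem_range.1 hj).trans_le hi)
      _ ≤ 1 / 2 * S := by rw [← Finset.sum_mul]; gcongr
  have h1 : N (∑ j ∈ Finset.range m, b j) ≤ C * S + 1 / 2 * S := by
    have := map_add_le_add N (∑ j ∈ Finset.range m, b j - ∑ j ∈ Finset.range m, a j)
      (∑ j ∈ Finset.range m, a j)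
    rw [sub_add_cancel] at this
    linarith [hdiff m hml, ha m hml]
  have h2 : S ≤ 2 * N (∑ j ∈ Finset.range l, b j) := by
    have := map_sub_le_add N (∑ j ∈ Finset.range l, b j)
      (∑ j ∈ Finset.range l, b j - ∑ j ∈ Finset.range l, a j)
    rw [sub_sub_cancel] at this
    linarith [hdiff l le_rfl]
  nlinarith

/-- If a C*-algebra `A` has a cb-basis `(x_i)`, then every infinite-dimensional closed
subspace `Y` of `A` contains a cb-basic sequence: norm-one elements `(y_j)` of `Y` and a
constant `K ≥ 1` with `‖∑_{j=1}^m u_j ⊗ y_j‖_{Mₙ(A)} ≤ K ‖∑_{j=1}^l u_j ⊗ y_j‖_{Mₙ(A)}`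
for all `n`, all `l ≥ m` and all `u_j ∈ Mₙ(ℂ)`.  Here `mnorm n` denotes the (necessarily
unique) C*-norm on `Mₙ(A)`, characterized by the listed axioms. -/
theorem infiniteDim_subspace_contains_cbBasicSequence
    {A : Type*} [NonUnitalCStarAlgebra A] [StarModule ℂ A]
    (mnorm : ∀ n : ℕ, Matrix (Fin n) (Fin n) A → ℝ)
    (mnorm_add : ∀ n (x y : Matrix (Fin n) (Fin n) A),
      mnorm n (x + y) ≤ mnorm n x + mnorm n y)
    (mnorm_smul : ∀ n (c : ℂ) (x : Matrix (Fin n) (Fin n) A),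
      mnorm n (c • x) = ‖c‖ * mnorm n x)
    (mnorm_mul : ∀ n (x y : Matrix (Fin n) (Fin n) A),
      mnorm n (x * y) ≤ mnorm n x * mnorm n y)
    (mnorm_star_mul_self : ∀ n (x : Matrix (Fin n) (Fin n) A),
      mnorm n (star x * x) = mnorm n x ^ 2)
    (mnorm_pos : ∀ n (x : Matrix (Fin n) (Fin n) A), x ≠ 0 → 0 < mnorm n x)
    (mnorm_one : ∀ a : A, mnorm 1 (Matrix.of fun _ _ => a) = ‖a‖)
    -- `(x_i)` is a Schauder basis of `A` ...
    (x : ℕ → A)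
    (hbasis : ∀ v : A, ∃! α : ℕ → ℂ,
      Tendsto (fun N => ∑ i ∈ Finset.range N, α i • x i) atTop (nhds v))
    -- ... whose basis projections are uniformly completely bounded (a cb-basis)
    (hcb : ∃ C : ℝ, ∀ (n : ℕ) (v : Matrix (Fin n) (Fin n) A) (α : Fin n → Fin n → ℕ → ℂ),
      (∀ p q, Tendsto (fun N => ∑ i ∈ Finset.range N, α p q i • x i) atTop (nhds (v p q))) →
      ∀ m : ℕ,
        mnorm n (Matrix.of fun p q => ∑ i ∈ Finset.range m, α p q i • x i) ≤ C * mnorm n v)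
    (Y : Submodule ℂ A) (hYclosed : IsClosed (Y : Set A))
    (hYinf : ¬ FiniteDimensional ℂ Y) :
    ∃ (y : ℕ → A) (K : ℝ),
      (∀ j, y j ∈ Y) ∧
      (∀ j, ‖y j‖ = 1) ∧
      1 ≤ K ∧
      (∀ (n : ℕ) (u : ℕ → Matrix (Fin n) (Fin n) ℂ) (m l : ℕ), m ≤ l →
        mnorm n (∑ j ∈ Finset.range m, Matrix.of fun p q => u j p q • y j) ≤
          K * mnorm n (∑ j ∈ Finset.range l, Matrix.of fun p q => u j p q • y j)) := by
  let N : ∀ n, Seminorm ℂ (Matrix (Fin n) (Fin n) A) := fun n =>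
    Seminorm.of (mnorm n) (mnorm_add n) (mnorm_smul n)
  have hN : ∀ n, IsCStarNorm (N n) := fun n =>
    ⟨mnorm_mul n, mnorm_star_mul_self n, mnorm_pos n⟩
  obtain ⟨C₀, hC₀⟩ := hcb
  obtain ⟨α, P, hPα, hPtends, hPcomm, hPfin⟩ := exists_basis_projections x hbasis
  set C := max C₀ 1 with hC
  have hC1 : 1 ≤ C := le_max_right _ _
  have hPN : ∀ n m (X : Matrix (Fin n) (Fin n) A),
      N n ((P m).mapMatrix X) ≤ C * N n X := by
    intro n m X
    have h := hC₀ n X (fun p q => α (X p q))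
      (fun p q => by simpa only [hPα] using hPtends (X p q)) m
    simp only [← hPα] at h
    exact h.trans (mul_le_mul_of_nonneg_right (le_max_left _ _) (apply_nonneg (N n) X))
  set ε : ℕ → ℝ := fun j => (1 / 2) ^ (j + 2) / (64 * C) with hε
  have hε0 : ∀ j, 0 < ε j := fun j => by positivity
  have hε1 : ∀ j, ε j ≤ 1 / 2 := fun j => by
    rw [hε, div_le_iff₀ (by positivity)]
    have : ((1 : ℝ) / 2) ^ (j + 2) ≤ 1 := pow_le_one₀ (by norm_num) (by norm_num)
    linarith
  obtain ⟨y, k, hk, hy⟩ := Y.exists_almost_block_sequence hYinf P hPtends hPfin ε hε0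
  refine ⟨y, 2 * C + 1, fun j => (hy j).1, fun j => (hy j).2.1, by linarith,
    fun n u m l hml => ?_⟩
  set z : ℕ → A := fun j => P (k (j + 1)) (y j) with hz
  have hzn : ∀ j, 1 / 2 ≤ ‖z j‖ := fun j => by
    have h1 := norm_sub_norm_le (y j) (z j)
    rw [(hy j).2.1] at h1
    linarith [(hy j).2.2.2, hε1 j]
  have hPz : ∀ i j, P (k i) (z j) = if j < i then z j else 0 := by
    intro i j
    simp only [hz, hPcomm]
    split_ifs with hij
    · rw [min_eq_right (hk hij)]
    · have h1 : k i ≤ k j := hk (not_lt.1 hij)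
      rw [min_eq_left (h1.trans (hk j.le_succ)), ← min_eq_left h1, ← hPcomm, (hy j).2.2.1,
        map_zero]
  refine (N n).sum_perturbation_le (a := fun j => Matrix.tens (u j) (z j))
    (b := fun j => Matrix.tens (u j) (y j)) hC1 hml (fun i hi => ?_) (fun j _ => ?_)
  · have h1 : ∑ j ∈ Finset.range i, Matrix.tens (u j) (z j) =
        (P (k i)).mapMatrix (∑ j ∈ Finset.range l, Matrix.tens (u j) (z j)) := by
      have h2 : ∀ j, (P (k i)).mapMatrix (Matrix.tens (u j) (z j)) =
          if j < i then Matrix.tens (u j) (z j) else 0 := by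
        intro j
        have h3 : (P (k i)).mapMatrix (Matrix.tens (u j) (z j)) =
            Matrix.tens (u j) (P (k i) (z j)) := by
          ext p q
          simp
        rw [h3, hPz]
        split_ifs <;> simp
      rw [map_sum]
      simp only [h2]
      rw [← Finset.sum_filter]
      congr 1
      ext j
      simp only [Finset.mem_range, Finset.mem_filter]
      omega
    rw [h1]
    exact hPN _ _ _
  · have h1 := (hN n).tens_mul_norm_le (u j) (y j - z j) (z j)
    rw [← map_sub]
    have h2 := apply_nonneg (N n) (Matrix.tens (u j) (y j - z j))
    have h3 := apply_nonneg (N n) (Matrix.tens (u j) (z j))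
    have h4 : 16 * ‖y j - z j‖ * N n (Matrix.tens (u j) (z j)) ≤
        16 * ε j * N n (Matrix.tens (u j) (z j)) := by
      gcongr
      exact (hy j).2.2.2
    have h5 : (1 / 2 : ℝ) ^ (j + 2) / (2 * C) = 32 * ε j := by
      simp only [hε]; field_simp; norm_num
    rw [h5]
    nlinarith [hzn j]
end
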